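/- Let d ≥ 1, q ≥ 1 and s > d/2 + 1. Then for every v ∈ h^s the following two identities hold: Σ_{k∈ℤ^d} Re( conj(v_k) · i R_k(v, q) ) = 0 and Σ_{k∈ℤ^d} λ_k · Re( conj(v_k) · i R_k(v, q) ) = 0, both series converging absolutely. (These identities express that H₁(v) = Σ_k |v_k|² and H₂(v) = Σ_k λ_k |v_k|² are integrals of motion of the hamiltonian part of the effective equation.) -/

import Mathlib

open scoped BigOperators

/-- `lam d k = |k|²`, the squared Euclidean norm of `k ∈ ℤ^d`. -/
def lam (d : ℕ) (k : Fin d → ℤ) : ℤ := ∑ i, (k i) ^ 2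

/-- The weight `|k|^{2s} + 1 = (|k|²)^s + 1` in the definition of the `h^s` norm. -/
noncomputable def wt (d : ℕ) (s : ℝ) (k : Fin d → ℤ) : ℝ := ((lam d k : ℝ)) ^ s + 1

/-- `v ∈ h^s`, i.e. the series defining `|v|_s²` converges. -/
def memH (d : ℕ) (s : ℝ) (v : (Fin d → ℤ) → ℂ) : Prop :=
  Summable fun k => wt d s k * ‖v k‖ ^ 2

/-- The norm `|v|_s` of `h^s`. -/
noncomputable def hnorm (d : ℕ) (s : ℝ) (v : (Fin d → ℤ) → ℂ) : ℝ :=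
  Real.sqrt (∑' k, wt d s k * ‖v k‖ ^ 2)

/-- The summand of `P_k(v,n)`: the monomial `v_{k₁} conj(v_{k₂}) ⋯ v_{k_{2n+1}}` if the
tuple `κ` lies in `S(k,n)` (i.e. the alternating sum of `κ` equals `k`), and `0` otherwise. -/
noncomputable def Pterm (d n : ℕ) (v : (Fin d → ℤ) → ℂ) (k : Fin d → ℤ)
    (κ : Fin (2 * n + 1) → (Fin d → ℤ)) : ℂ :=
  if (∑ j : Fin (2 * n + 1), ((-1 : ℤ) ^ (j : ℕ)) • κ j) = k then
    ∏ j : Fin (2 * n + 1), (if Even (j : ℕ) then v (κ j) else (starRingEnd ℂ) (v (κ j)))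
  else 0

/-- `P_k(v,n) = Σ_{(k₁,…,k_{2n+1}) ∈ S(k,n)} v_{k₁} conj(v_{k₂}) ⋯ v_{k_{2n+1}}`. -/
noncomputable def Pk (d n : ℕ) (v : (Fin d → ℤ) → ℂ) (k : Fin d → ℤ) : ℂ :=
  ∑' κ : Fin (2 * n + 1) → (Fin d → ℤ), Pterm d n v k κ

/-- The summand of `R_k(v,n)`: as `Pterm`, but restricted to resonant tuples. -/
noncomputable def Rterm (d n : ℕ) (v : (Fin d → ℤ) → ℂ) (k : Fin d → ℤ)
    (κ : Fin (2 * n + 1) → (Fin d → ℤ)) : ℂ :=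
  if (∑ j : Fin (2 * n + 1), ((-1 : ℤ) ^ (j : ℕ)) • κ j) = k ∧
      (∑ j : Fin (2 * n + 1), ((-1 : ℤ) ^ (j : ℕ)) * lam d (κ j)) = lam d k then
    ∏ j : Fin (2 * n + 1), (if Even (j : ℕ) then v (κ j) else (starRingEnd ℂ) (v (κ j)))
  else 0

/-- `R_k(v,n)`, the resonant part of `P_k(v,n)`. -/
noncomputable def Rk (d n : ℕ) (v : (Fin d → ℤ) → ℂ) (k : Fin d → ℤ) : ℂ :=
  ∑' κ : Fin (2 * n + 1) → (Fin d → ℤ), Rterm d n v k κ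

lemma lam_nonneg (d : ℕ) (k : Fin d → ℤ) : 0 ≤ lam d k :=
  Finset.sum_nonneg fun i _ => sq_nonneg (k i)

lemma lam_cast_nonneg (d : ℕ) (k : Fin d → ℤ) : (0 : ℝ) ≤ lam d k := by
  exact_mod_cast lam_nonneg d k

/-- If `f` is nonnegative and summable, so is the function `κ ↦ ∏ i, f (κ i)` on tuples. -/
lemma summable_prod_tuple {α : Type*} {f : α → ℝ} (hf0 : ∀ a, 0 ≤ f a) (hf : Summable f) :
    ∀ n : ℕ, Summable fun κ : Fin n → α => ∏ i, f (κ i)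
  | 0 => Summable.of_finite
  | n + 1 => by
    have h := hf.mul_of_nonneg (summable_prod_tuple hf0 hf n) hf0
      fun κ => Finset.prod_nonneg fun i _ => hf0 (κ i)
    rw [← (Fin.snocEquiv fun _ : Fin (n + 1) => α).summable_iff]
    refine h.congr fun p => ?_
    simp [Fin.snocEquiv, Fin.prod_univ_castSucc, mul_comm]

lemma one_add_sum_le_prod_one_add {ι : Type*} (t : Finset ι) {f : ι → ℝ} (hf : ∀ i, 0 ≤ f i) :
    1 + ∑ i ∈ t, f i ≤ ∏ i ∈ t, (1 + f i) := by
  classical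
  induction t using Finset.induction_on with
  | empty => simp
  | insert a t ha ih =>
    rw [Finset.sum_insert ha, Finset.prod_insert ha]
    have := Finset.sum_nonneg fun i (_ : i ∈ t) => hf i
    nlinarith [hf a, mul_nonneg (hf a) this, mul_le_mul_of_nonneg_left ih (hf a)]

lemma summable_one_add_sq_rpow {r : ℝ} (hr : 1 / 2 < r) :
    Summable fun n : ℤ => (1 + (n : ℝ) ^ 2) ^ (-r) := by
  refine (Real.summable_abs_int_rpow (b := 2 * r) (by linarith)).of_norm_bounded_eventually
    (g := fun n : ℤ => |(n : ℝ)| ^ (-(2 * r))) ?_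
  have : ∀ᶠ n : ℤ in Filter.cofinite, n ≠ 0 := Filter.eventually_cofinite_ne 0
  filter_upwards [this] with n hn
  have hn' : (0 : ℝ) < |(n : ℝ)| := abs_pos.2 (by exact_mod_cast hn)
  rw [Real.norm_of_nonneg (by positivity)]
  have : |(n : ℝ)| ^ (-(2 * r)) = ((n : ℝ) ^ 2) ^ (-r) := by
    rw [← sq_abs, ← Real.rpow_natCast, ← Real.rpow_mul hn'.le]
    congr 1
    push_cast
    ring
  rw [this]
  have hpos : (0 : ℝ) < (n : ℝ) ^ 2 := by rw [← sq_abs]; positivity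
  exact Real.rpow_le_rpow_of_nonpos hpos (by linarith) (by linarith)

/-- Convergence of the lattice sum `∑ (1 + |k|²)^(-r)` over `ℤ^d` for `r > d / 2`. -/
lemma summable_one_add_lam_rpow {d : ℕ} (hd : 1 ≤ d) {r : ℝ} (hr : (d : ℝ) / 2 < r) :
    Summable fun k : Fin d → ℤ => (1 + (lam d k : ℝ)) ^ (-r) := by
  have hd0 : (0 : ℝ) < d := by exact_mod_cast hd
  have hrd : 1 / 2 < r / d := by rw [lt_div_iff₀ hd0]; linarith
  refine (summable_prod_tuple (fun n : ℤ => by positivity)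
    (summable_one_add_sq_rpow hrd) d).of_nonneg_of_le
    (fun k => Real.rpow_nonneg (by linarith [lam_cast_nonneg d k]) _) fun k => ?_
  have hl := lam_cast_nonneg d k
  have hle : ∏ i, (1 + (k i : ℝ) ^ 2) ≤ (1 + (lam d k : ℝ)) ^ d := by
    calc ∏ i, (1 + (k i : ℝ) ^ 2) ≤ ∏ _i : Fin d, (1 + (lam d k : ℝ)) := by
          refine Finset.prod_le_prod (fun i _ => by positivity) fun i _ => ?_
          have : (k i) ^ 2 ≤ lam d k :=
            Finset.single_le_sum (f := fun i => (k i) ^ 2) (fun i _ => sq_nonneg (k i))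
              (Finset.mem_univ i)
          have : ((k i : ℝ)) ^ 2 ≤ lam d k := by exact_mod_cast this
          linarith
      _ = _ := by simp
  have hpos : 0 < ∏ i, (1 + (k i : ℝ) ^ 2) := Finset.prod_pos fun i _ => by positivity
  rw [Real.finsetProd_rpow _ _ fun i _ => by positivity]
  have : (1 + (lam d k : ℝ)) ^ (-r) = ((1 + (lam d k : ℝ)) ^ d) ^ (-(r / d)) := by
    rw [← Real.rpow_natCast, ← Real.rpow_mul (by linarith)]
    congr 1
    field_simp
  rw [this]
  exact Real.rpow_le_rpow_of_nonpos hpos hle (by linarith)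

lemma one_add_rpow_le {x s : ℝ} (hx : 0 ≤ x) (hs : 0 ≤ s) :
    (1 + x) ^ s ≤ 2 ^ s * (x ^ s + 1) := by
  have hxs := Real.rpow_nonneg hx s
  have h2 := Real.rpow_nonneg (zero_le_two (α := ℝ)) s
  rcases le_total x 1 with h | h
  · calc (1 + x) ^ s ≤ 2 ^ s := Real.rpow_le_rpow (by linarith) (by linarith) hs
      _ ≤ _ := le_mul_of_one_le_right h2 (by linarith)
  · calc (1 + x) ^ s ≤ (2 * x) ^ s := Real.rpow_le_rpow (by linarith) (by linarith) hs
      _ = 2 ^ s * x ^ s := Real.mul_rpow zero_le_two hx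
      _ ≤ _ := mul_le_mul_of_nonneg_left (by linarith) h2

/-- A sequence in `h^s`, `s > d / 2 + 1`, is summable against the weight `(1 + |k|²)^(1/2)`. -/
lemma memH.summable_sqrt_mul {d : ℕ} (hd : 1 ≤ d) {s : ℝ} (hs : (d : ℝ) / 2 + 1 < s)
    {v : (Fin d → ℤ) → ℂ} (hv : memH d s v) :
    Summable fun k => √(1 + (lam d k : ℝ)) * ‖v k‖ := by
  have hd0 : (0 : ℝ) < d := by exact_mod_cast hd
  have hsum := ((Summable.mul_left (2 ^ s) hv).add
    (summable_one_add_lam_rpow hd (r := s - 1) (by linarith)))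
  refine hsum.of_nonneg_of_le (fun k => by positivity) fun k => ?_
  have hl := lam_cast_nonneg d k
  set x : ℝ := 1 + (lam d k : ℝ) with hx
  have hx0 : 0 < x := by linarith
  have h1 : √x * ‖v k‖ = (x ^ (s / 2) * ‖v k‖) * x ^ (-(s - 1) / 2) := by
    rw [mul_right_comm, ← Real.rpow_add hx0, Real.sqrt_eq_rpow]
    congr 2
    ring
  have h2 : (x ^ (s / 2)) ^ 2 = x ^ s := by
    rw [← Real.rpow_natCast, ← Real.rpow_mul hx0.le]
    congr 1
    push_cast
    ring
  have h3 : (x ^ (-(s - 1) / 2)) ^ 2 = x ^ (-(s - 1)) := by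
    rw [← Real.rpow_natCast, ← Real.rpow_mul hx0.le]
    congr 1
    push_cast
    ring
  have h4 : x ^ s * ‖v k‖ ^ 2 ≤ 2 ^ s * (wt d s k * ‖v k‖ ^ 2) := by
    rw [← mul_assoc]
    exact mul_le_mul_of_nonneg_right (one_add_rpow_le hl (by linarith)) (sq_nonneg _)
  have h5 := two_mul_le_add_sq (x ^ (s / 2) * ‖v k‖) (x ^ (-(s - 1) / 2))
  have h6 : 0 ≤ x ^ (s / 2) * ‖v k‖ * x ^ (-(s - 1) / 2) := by positivity
  rw [mul_pow, h2, h3] at h5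
  rw [h1]
  linarith

/-- The resonant monomial `v_{k₀} conj(v_{k₁}) v_{k₂} ⋯` of length `N`, symmetric in all indices:
it vanishes unless both alternating sums `∑ ± k_j` and `∑ ± |k_j|²` are zero. -/
noncomputable def resonantTerm (d N : ℕ) (v : (Fin d → ℤ) → ℂ) (κ : Fin N → (Fin d → ℤ)) : ℂ :=
  if (∑ j : Fin N, ((-1 : ℤ) ^ (j : ℕ)) • κ j) = 0 ∧
      (∑ j : Fin N, ((-1 : ℤ) ^ (j : ℕ)) * lam d (κ j)) = 0 then
    ∏ j : Fin N, (if Even (j : ℕ) then v (κ j) else (starRingEnd ℂ) (v (κ j)))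
  else 0

lemma resonantTerm_snoc (d n : ℕ) (v : (Fin d → ℤ) → ℂ) (k : Fin d → ℤ)
    (κ : Fin (2 * n + 1) → (Fin d → ℤ)) :
    resonantTerm d (2 * n + 1 + 1) v (Fin.snoc (α := fun _ => Fin d → ℤ) κ k) =
      (starRingEnd ℂ) (v k) * Rterm d n v k κ := by
  have hodd : Odd (2 * n + 1) := odd_two_mul_add_one n
  have hne : ¬ Even (2 * n + 1) := Nat.not_even_iff_odd.2 hodd
  simp only [resonantTerm, Rterm, Fin.sum_univ_castSucc (n := 2 * n + 1),
    Fin.prod_univ_castSucc (n := 2 * n + 1), Fin.snoc_castSucc, Fin.snoc_last, Fin.val_castSucc,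
    Fin.val_last, hodd.neg_one_pow, neg_smul, one_smul, neg_mul, one_mul, ← sub_eq_add_neg,
    sub_eq_zero, if_neg hne, mul_ite, mul_zero]
  simp only [mul_comm]

/-- Reversing a tuple of even length conjugates the resonant monomial. -/
lemma resonantTerm_comp_rev (d m : ℕ) (v : (Fin d → ℤ) → ℂ)
    (κ : Fin (2 * m) → (Fin d → ℤ)) :
    resonantTerm d (2 * m) v (κ ∘ Fin.revPerm) =
      (starRingEnd ℂ) (resonantTerm d (2 * m) v κ) := by
  have hpar : ∀ j : Fin (2 * m), Even (j : ℕ) ↔ ¬ Even ((Fin.revPerm j : Fin (2 * m)) : ℕ) := by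
    intro j
    have := j.2
    simp only [Fin.revPerm_apply, Fin.val_rev, Nat.even_iff]
    omega
  have hsign : ∀ j : Fin (2 * m),
      (-1 : ℤ) ^ (j : ℕ) = -(-1 : ℤ) ^ ((Fin.revPerm j : Fin (2 * m)) : ℕ) := by
    intro j
    by_cases h : Even (j : ℕ)
    · have h' := Nat.not_even_iff_odd.1 ((hpar j).1 h)
      rw [h.neg_one_pow, h'.neg_one_pow, neg_neg]
    · have h' := not_not.1 (mt (hpar j).2 h)
      rw [(Nat.not_even_iff_odd.1 h).neg_one_pow, h'.neg_one_pow]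
  have h1 : (∑ j : Fin (2 * m), ((-1 : ℤ) ^ (j : ℕ)) • (κ ∘ Fin.revPerm) j) =
      -∑ j : Fin (2 * m), ((-1 : ℤ) ^ (j : ℕ)) • κ j := by
    rw [← Equiv.sum_comp Fin.revPerm (fun j : Fin (2 * m) => ((-1 : ℤ) ^ (j : ℕ)) • κ j),
      ← Finset.sum_neg_distrib]
    exact Finset.sum_congr rfl fun j _ => by rw [hsign j, neg_smul]; rfl
  have h2 : (∑ j : Fin (2 * m), ((-1 : ℤ) ^ (j : ℕ)) * lam d ((κ ∘ Fin.revPerm) j)) =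
      -∑ j : Fin (2 * m), ((-1 : ℤ) ^ (j : ℕ)) * lam d (κ j) := by
    rw [← Equiv.sum_comp Fin.revPerm
      (fun j : Fin (2 * m) => ((-1 : ℤ) ^ (j : ℕ)) * lam d (κ j)), ← Finset.sum_neg_distrib]
    exact Finset.sum_congr rfl fun j _ => by rw [hsign j, neg_mul]; rfl
  have h3 : (∏ j : Fin (2 * m), (if Even (j : ℕ) then v ((κ ∘ Fin.revPerm) j)
        else (starRingEnd ℂ) (v ((κ ∘ Fin.revPerm) j)))) =
      (starRingEnd ℂ) (∏ j : Fin (2 * m),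
        (if Even (j : ℕ) then v (κ j) else (starRingEnd ℂ) (v (κ j)))) := by
    rw [map_prod, ← Equiv.prod_comp Fin.revPerm (fun j : Fin (2 * m) => (starRingEnd ℂ)
      (if Even (j : ℕ) then v (κ j) else (starRingEnd ℂ) (v (κ j))))]
    refine Finset.prod_congr rfl fun j _ => ?_
    by_cases h : Even (j : ℕ)
    · rw [if_pos h, if_neg ((hpar j).1 h), Complex.conj_conj]; rfl
    · rw [if_neg h, if_pos (not_not.1 (mt (hpar j).2 h))]; rfl
  simp only [resonantTerm, h1, h2, h3, neg_eq_zero]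
  split_ifs <;> simp

/-- Permutations that respect the parity of the positions leave the resonant monomial unchanged. -/
lemma resonantTerm_comp_perm (d N : ℕ) (v : (Fin d → ℤ) → ℂ) (κ : Fin N → (Fin d → ℤ))
    (σ : Equiv.Perm (Fin N)) (hσ : ∀ j : Fin N, Even (j : ℕ) ↔ Even (σ j : ℕ)) :
    resonantTerm d N v (κ ∘ σ) = resonantTerm d N v κ := by
  have hsign : ∀ j : Fin N, (-1 : ℤ) ^ (j : ℕ) = (-1 : ℤ) ^ (σ j : ℕ) := by
    intro j
    by_cases h : Even (j : ℕ)
    · rw [h.neg_one_pow, ((hσ j).1 h).neg_one_pow]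
    · rw [(Nat.not_even_iff_odd.1 h).neg_one_pow,
        (Nat.not_even_iff_odd.1 (mt (hσ j).2 h)).neg_one_pow]
  have h1 := Equiv.sum_comp σ (fun j : Fin N => ((-1 : ℤ) ^ (j : ℕ)) • κ j)
  have h2 := Equiv.sum_comp σ (fun j : Fin N => ((-1 : ℤ) ^ (j : ℕ)) * lam d (κ j))
  have h3 := Equiv.prod_comp σ
    (fun j : Fin N => if Even (j : ℕ) then v (κ j) else (starRingEnd ℂ) (v (κ j)))
  simp only [← hsign, ← hσ] at h1 h2 h3
  simp only [resonantTerm, Function.comp_apply, h1, h2, h3]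

/-- Under the resonance condition, one mode is controlled by all the others. -/
lemma one_add_lam_le_prod_sqrt {d N : ℕ} {κ : Fin N → (Fin d → ℤ)}
    (h : (∑ j : Fin N, ((-1 : ℤ) ^ (j : ℕ)) * lam d (κ j)) = 0) (i : Fin N) :
    1 + (lam d (κ i) : ℝ) ≤ ∏ j, √(1 + (lam d (κ j) : ℝ)) := by
  have hle : lam d (κ i) ≤ ∑ j ∈ Finset.univ.erase i, lam d (κ j) := by
    rw [← Finset.add_sum_erase _ _ (Finset.mem_univ i)] at h
    calc lam d (κ i) = |(-1 : ℤ) ^ (i : ℕ) * lam d (κ i)| := by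
          rw [abs_mul, abs_neg_one_pow, one_mul, abs_of_nonneg (lam_nonneg d _)]
      _ = |∑ j ∈ Finset.univ.erase i, (-1 : ℤ) ^ (j : ℕ) * lam d (κ j)| := by
          rw [eq_neg_of_add_eq_zero_left h, abs_neg]
      _ ≤ ∑ j ∈ Finset.univ.erase i, |(-1 : ℤ) ^ (j : ℕ) * lam d (κ j)| :=
          Finset.abs_sum_le_sum_abs _ _
      _ = _ := Finset.sum_congr rfl fun j _ => by
          rw [abs_mul, abs_neg_one_pow, one_mul, abs_of_nonneg (lam_nonneg d _)]
  have hle' : (lam d (κ i) : ℝ) ≤ ∑ j ∈ Finset.univ.erase i, (lam d (κ j) : ℝ) := by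
    exact_mod_cast hle
  have hi := lam_cast_nonneg d (κ i)
  have hprod := one_add_sum_le_prod_one_add (Finset.univ.erase i)
    fun j => lam_cast_nonneg d (κ j)
  refine le_of_sq_le_sq ?_ (Finset.prod_nonneg fun j _ => Real.sqrt_nonneg _)
  rw [← Finset.prod_pow, Finset.prod_congr rfl fun j _ =>
    Real.sq_sqrt (by linarith [lam_cast_nonneg d (κ j)] : 0 ≤ 1 + (lam d (κ j) : ℝ)),
    ← Finset.mul_prod_erase _ _ (Finset.mem_univ i), sq]
  exact mul_le_mul_of_nonneg_left (by linarith) (by linarith)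

lemma norm_mul_resonantTerm_le {d N : ℕ} (v : (Fin d → ℤ) → ℂ) (κ : Fin N → (Fin d → ℤ))
    (i : Fin N) {w : ℝ} (hw0 : 0 ≤ w) (hw : w ≤ 1 + lam d (κ i)) :
    ‖(w : ℂ) * resonantTerm d N v κ‖ ≤ ∏ j, √(1 + (lam d (κ j) : ℝ)) * ‖v (κ j)‖ := by
  rw [resonantTerm]
  split_ifs with h
  · rw [norm_mul, Complex.norm_of_nonneg hw0, norm_prod, Finset.prod_mul_distrib]
    refine mul_le_mul (hw.trans (one_add_lam_le_prod_sqrt h.2 i)) (le_of_eq ?_)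
      (Finset.prod_nonneg fun j _ => norm_nonneg _)
      (Finset.prod_nonneg fun j _ => Real.sqrt_nonneg _)
    refine Finset.prod_congr rfl fun j _ => ?_
    split_ifs <;> simp
  · rw [mul_zero, norm_zero]
    exact Finset.prod_nonneg fun j _ => by positivity

section

variable {d : ℕ} {v : (Fin d → ℤ) → ℂ}

lemma summable_mul_resonantTerm (hv : Summable fun k => √(1 + (lam d k : ℝ)) * ‖v k‖)
    (N : ℕ) (i : Fin N) {w : (Fin d → ℤ) → ℝ} (hw0 : ∀ k, 0 ≤ w k)
    (hw : ∀ k, w k ≤ 1 + lam d k) :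
    Summable fun κ : Fin N → (Fin d → ℤ) => (w (κ i) : ℂ) * resonantTerm d N v κ :=
  (summable_prod_tuple (fun _ => by positivity) hv N).of_norm_bounded
    fun κ => norm_mul_resonantTerm_le v κ i (hw0 _) (hw _)

lemma im_tsum_resonantTerm (v : (Fin d → ℤ) → ℂ) (m : ℕ) :
    (∑' κ : Fin (2 * m) → (Fin d → ℤ), resonantTerm d (2 * m) v κ).im = 0 := by
  rw [← Complex.conj_eq_iff_im, Complex.conj_tsum,
    ← (Equiv.arrowCongr (Fin.revPerm (n := 2 * m)) (Equiv.refl (Fin d → ℤ))).tsum_eq]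
  exact tsum_congr fun κ => by
    rw [← resonantTerm_comp_rev]
    congr 1
    ext j
    simp [Equiv.arrowCongr]

lemma tsum_lam_rev_mul_resonantTerm (v : (Fin d → ℤ) → ℂ) (m : ℕ) (i : Fin (2 * m)) :
    (∑' κ : Fin (2 * m) → (Fin d → ℤ), (lam d (κ i.rev) : ℂ) * resonantTerm d (2 * m) v κ) =
      (starRingEnd ℂ) (∑' κ : Fin (2 * m) → (Fin d → ℤ),
        (lam d (κ i) : ℂ) * resonantTerm d (2 * m) v κ) := by
  rw [Complex.conj_tsum,
    ← (Equiv.arrowCongr (Fin.revPerm (n := 2 * m)) (Equiv.refl (Fin d → ℤ))).tsum_eq]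
  refine tsum_congr fun κ => ?_
  rw [map_mul, ← resonantTerm_comp_rev]
  simp [Equiv.arrowCongr, Function.comp_def]

lemma tsum_lam_mul_resonantTerm_eq (v : (Fin d → ℤ) → ℂ) (N : ℕ) {i j : Fin N}
    (hij : Even (i : ℕ) ↔ Even (j : ℕ)) :
    (∑' κ : Fin N → (Fin d → ℤ), (lam d (κ i) : ℂ) * resonantTerm d N v κ) =
      ∑' κ : Fin N → (Fin d → ℤ), (lam d (κ j) : ℂ) * resonantTerm d N v κ := by
  rw [← (Equiv.arrowCongr (Equiv.swap i j) (Equiv.refl (Fin d → ℤ))).tsum_eq]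
  refine tsum_congr fun κ => ?_
  have hσ : ∀ l : Fin N, Even (l : ℕ) ↔ Even ((Equiv.swap i j l : Fin N) : ℕ) := by
    intro l
    rw [Equiv.swap_apply_def]
    split_ifs with h1 h2
    · rw [h1, hij]
    · rw [h2, hij]
    · rfl
  have h : (Equiv.arrowCongr (Equiv.swap i j) (Equiv.refl (Fin d → ℤ))) κ =
      κ ∘ Equiv.swap i j := rfl
  rw [h, resonantTerm_comp_perm d N v κ _ hσ, Function.comp_apply, Equiv.swap_apply_left]

lemma im_tsum_lam_mul_resonantTerm (hv : Summable fun k => √(1 + (lam d k : ℝ)) * ‖v k‖)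
    (m : ℕ) {i : Fin (2 * m)} (hi : ¬ Even (i : ℕ)) :
    (∑' κ : Fin (2 * m) → (Fin d → ℤ),
      (lam d (κ i) : ℂ) * resonantTerm d (2 * m) v κ).im = 0 := by
  set A : Fin (2 * m) → ℂ := fun j => ∑' κ : Fin (2 * m) → (Fin d → ℤ),
    (lam d (κ j) : ℂ) * resonantTerm d (2 * m) v κ with hA
  have hsum : ∀ j, Summable fun κ : Fin (2 * m) → (Fin d → ℤ) =>
      (lam d (κ j) : ℂ) * resonantTerm d (2 * m) v κ := fun j => by
    simpa using summable_mul_resonantTerm hv (2 * m) j (w := fun k => (lam d k : ℝ))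
      (fun k => lam_cast_nonneg d k) fun k => by linarith
  have hzero : ∑ j : Fin (2 * m), (-1 : ℂ) ^ (j : ℕ) * A j = 0 := by
    simp only [hA, ← tsum_mul_left]
    rw [← Summable.tsum_finsetSum fun j _ => (hsum j).mul_left _, ← tsum_zero]
    refine tsum_congr fun κ => ?_
    simp only [← mul_assoc]
    rw [← Finset.sum_mul, resonantTerm]
    split_ifs with h
    · have : (∑ j : Fin (2 * m), (-1 : ℂ) ^ (j : ℕ) * (lam d (κ j) : ℂ)) = 0 := by
        exact_mod_cast congrArg (Int.cast : ℤ → ℂ) h.2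
      rw [this, zero_mul]
    · rw [mul_zero]
  have him : ∀ j : Fin (2 * m), ((-1 : ℂ) ^ (j : ℕ) * A j).im = -(A i).im := by
    intro j
    by_cases hj : Even (j : ℕ)
    · have hrev : ¬ Even ((j.rev : Fin (2 * m)) : ℕ) := by
        have := j.2
        simp only [Fin.val_rev, Nat.even_iff] at hj ⊢
        omega
      have h1 : A j = (starRingEnd ℂ) (A j.rev) := by
        have := tsum_lam_rev_mul_resonantTerm v m j.rev
        rwa [Fin.rev_rev] at this
      have h2 : A j.rev = A i := tsum_lam_mul_resonantTerm_eq v (2 * m) (by tauto)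
      rw [hj.neg_one_pow, one_mul, h1, h2, Complex.conj_im]
    · have h2 : A j = A i := tsum_lam_mul_resonantTerm_eq v (2 * m) (by tauto)
      rw [(Nat.not_even_iff_odd.1 hj).neg_one_pow, h2, neg_one_mul, Complex.neg_im]
  have h := congrArg Complex.im hzero
  rw [Complex.im_sum, Finset.sum_congr rfl fun j _ => him j] at h
  have hm : (m : ℝ) ≠ 0 := by
    have := i.2
    exact_mod_cast (by omega : m ≠ 0)
  simpa [hm] using h

/-- Sums over `k` of weighted terms `conj(v_k) · i R_k` reduce to sums over full tuples. -/
lemma summable_and_tsum_re_eq_zero (hv : Summable fun k => √(1 + (lam d k : ℝ)) * ‖v k‖)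
    (q : ℕ) {w : (Fin d → ℤ) → ℝ} (hw0 : ∀ k, 0 ≤ w k) (hw : ∀ k, w k ≤ 1 + lam d k)
    (him : (∑' κ : Fin (2 * q + 1 + 1) → (Fin d → ℤ),
      (w (κ (Fin.last _)) : ℂ) * resonantTerm d (2 * q + 1 + 1) v κ).im = 0) :
    (Summable fun k => w k * ((starRingEnd ℂ) (v k) * (Complex.I * Rk d q v k)).re) ∧
    (∑' k, w k * ((starRingEnd ℂ) (v k) * (Complex.I * Rk d q v k)).re) = 0 := by
  have hs := summable_mul_resonantTerm hv (2 * q + 1 + 1) (Fin.last _) hw0 hw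
  rw [← (Fin.snocEquiv fun _ : Fin (2 * q + 1 + 1) => (Fin d → ℤ)).tsum_eq] at him
  rw [← (Fin.snocEquiv fun _ : Fin (2 * q + 1 + 1) => (Fin d → ℤ)).summable_iff] at hs
  simp only [Function.comp_def, Fin.snocEquiv, Equiv.coe_fn_mk, Fin.snoc_last,
    resonantTerm_snoc] at him hs
  have hfib : ∀ k, (∑' κ, (w k : ℂ) * ((starRingEnd ℂ) (v k) * Rterm d q v k κ)) =
      (w k : ℂ) * ((starRingEnd ℂ) (v k) * Rk d q v k) := fun k => by
    rw [tsum_mul_left, tsum_mul_left, Rk]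
  have hsk : Summable fun k => (w k : ℂ) * ((starRingEnd ℂ) (v k) * Rk d q v k) :=
    hs.prod.congr hfib
  rw [hs.tsum_prod, tsum_congr hfib, Complex.im_tsum hsk] at him
  have hre : ∀ k, w k * ((starRingEnd ℂ) (v k) * (Complex.I * Rk d q v k)).re =
      -((w k : ℂ) * ((starRingEnd ℂ) (v k) * Rk d q v k)).im := fun k => by
    rw [mul_left_comm, Complex.I_mul_re, Complex.im_ofReal_mul, mul_neg]
  simp only [hre]
  exact ⟨(Complex.imCLM.summable hsk).neg, by rw [tsum_neg, him, neg_zero]⟩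

end

/-- For `d ≥ 1`, `q ≥ 1`, `s > d/2 + 1` and `v ∈ h^s`, the quantities
`H₁(v) = Σ|v_k|²` and `H₂(v) = Σ λ_k |v_k|²` are conserved by the hamiltonian part
of the effective equation: `Σ_k Re(conj(v_k) · i R_k(v,q)) = 0` and
`Σ_k λ_k Re(conj(v_k) · i R_k(v,q)) = 0`, both series converging absolutely. -/
theorem effective_equation_integrals (d q : ℕ) (hd : 1 ≤ d) (hq : 1 ≤ q) (s : ℝ)
    (hs : (d : ℝ) / 2 + 1 < s) (v : (Fin d → ℤ) → ℂ) (hv : memH d s v) :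
    (Summable fun k => ((starRingEnd ℂ) (v k) * (Complex.I * Rk d q v k)).re) ∧
    (∑' k, ((starRingEnd ℂ) (v k) * (Complex.I * Rk d q v k)).re) = 0 ∧
    (Summable fun k => (lam d k : ℝ) * ((starRingEnd ℂ) (v k) * (Complex.I * Rk d q v k)).re) ∧
    (∑' k, (lam d k : ℝ) * ((starRingEnd ℂ) (v k) * (Complex.I * Rk d q v k)).re) = 0 := by
  have hsum := hv.summable_sqrt_mul hd hs
  have h1 := summable_and_tsum_re_eq_zero hsum q (w := fun _ => 1) (fun _ => zero_le_one)
    (fun k => by linarith [lam_cast_nonneg d k])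
    (by simpa only [Complex.ofReal_one, one_mul] using! im_tsum_resonantTerm v (q + 1))
  have h2 := summable_and_tsum_re_eq_zero hsum q (w := fun k => (lam d k : ℝ))
    (fun k => lam_cast_nonneg d k) (fun k => by linarith)
    (by
      have hlast : ¬ Even ((Fin.last (2 * q + 1) : Fin (2 * (q + 1))) : ℕ) := by
        simp
      simpa only [Complex.ofReal_intCast] using! im_tsum_lam_mul_resonantTerm hsum (q + 1) hlast)
  simp only [one_mul] at h1
  exact ⟨h1.1, h1.2, h2.1, h2.2⟩
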